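/- There does not exist a 4-dimensional linear subspace M of the space of skew-symmetric 6×6 complex matrices such that every nonzero matrix in M has rank 4. -/

import Mathlib

open Matrix

section pfaff
variable {R : Type*} [CommRing R]

/-- The Pfaffian adjoint of a skew 6×6 matrix. -/
def pf4 (A : Matrix (Fin 6) (Fin 6) R) (i j k l : Fin 6) : R :=
  A i j * A k l - A i k * A j l + A i l * A j k

def pfAdj (A : Matrix (Fin 6) (Fin 6) R) : Matrix (Fin 6) (Fin 6) R :=
  !![0, -pf4 A 2 3 4 5, pf4 A 1 3 4 5, -pf4 A 1 2 4 5, pf4 A 1 2 3 5, -pf4 A 1 2 3 4;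
     pf4 A 2 3 4 5, 0, -pf4 A 0 3 4 5, pf4 A 0 2 4 5, -pf4 A 0 2 3 5, pf4 A 0 2 3 4;
     -pf4 A 1 3 4 5, pf4 A 0 3 4 5, 0, -pf4 A 0 1 4 5, pf4 A 0 1 3 5, -pf4 A 0 1 3 4;
     pf4 A 1 2 4 5, -pf4 A 0 2 4 5, pf4 A 0 1 4 5, 0, -pf4 A 0 1 2 5, pf4 A 0 1 2 4;
     -pf4 A 1 2 3 5, pf4 A 0 2 3 5, -pf4 A 0 1 3 5, pf4 A 0 1 2 5, 0, -pf4 A 0 1 2 3;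
     pf4 A 1 2 3 4, -pf4 A 0 2 3 4, pf4 A 0 1 3 4, -pf4 A 0 1 2 4, pf4 A 0 1 2 3, 0]

def pfPol (A X : Matrix (Fin 6) (Fin 6) R) : Matrix (Fin 6) (Fin 6) R :=
  pfAdj (A + X) - pfAdj A - pfAdj X

def pfTau (A X : Matrix (Fin 6) (Fin 6) R) : R :=
  -(X 0 1 * pfAdj A 0 1 + X 0 2 * pfAdj A 0 2 + X 0 3 * pfAdj A 0 3 + X 0 4 * pfAdj A 0 4
   + X 0 5 * pfAdj A 0 5 + X 1 2 * pfAdj A 1 2 + X 1 3 * pfAdj A 1 3 + X 1 4 * pfAdj A 1 4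
   + X 1 5 * pfAdj A 1 5 + X 2 3 * pfAdj A 2 3 + X 2 4 * pfAdj A 2 4 + X 2 5 * pfAdj A 2 5
   + X 3 4 * pfAdj A 3 4 + X 3 5 * pfAdj A 3 5 + X 4 5 * pfAdj A 4 5)

def pf6 (A : Matrix (Fin 6) (Fin 6) R) : R :=
  -(A 0 1 * pfAdj A 0 1 + A 0 2 * pfAdj A 0 2 + A 0 3 * pfAdj A 0 3 + A 0 4 * pfAdj A 0 4
   + A 0 5 * pfAdj A 0 5)

def skM (a b c d e f g h i j k l m n o : R) : Matrix (Fin 6) (Fin 6) R :=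
  !![0, a, b, c, d, e; -a, 0, f, g, h, i; -b, -f, 0, j, k, l; -c, -g, -j, 0, m, n;
     -d, -h, -k, -m, 0, o; -e, -i, -l, -n, -o, 0]

def IsSk (A : Matrix (Fin 6) (Fin 6) R) : Prop := (∀ i, A i i = 0) ∧ ∀ i j, A i j = -A j i

lemma IsSk.eq_skM {A : Matrix (Fin 6) (Fin 6) R} (h : IsSk A) :
    ∃ a b c d e f g h i j k l m n o, A = skM a b c d e f g h i j k l m n o := by
  refine ⟨A 0 1, A 0 2, A 0 3, A 0 4, A 0 5, A 1 2, A 1 3, A 1 4, A 1 5, A 2 3, A 2 4, A 2 5,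
    A 3 4, A 3 5, A 4 5, ?_⟩
  obtain ⟨h0, h1⟩ := h
  ext i j
  fin_cases i <;> fin_cases j <;> first | exact h0 _ | rfl | exact h1 _ _

set_option maxHeartbeats 4000000 in
lemma mul_pfAdj {A : Matrix (Fin 6) (Fin 6) R} (h : IsSk A) : A * pfAdj A = pf6 A • 1 := by
  obtain ⟨a, b, c, d, e, f, g, h, i, j, k, l, m, n, o, rfl⟩ := h.eq_skM
  ext p q
  fin_cases p <;> fin_cases q <;>
    simp [Matrix.mul_apply, Fin.sum_univ_six, pf6, pfAdj, pf4, skM] <;> ring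

lemma pfAdj_transpose (A : Matrix (Fin 6) (Fin 6) R) : (pfAdj A)ᵀ = -pfAdj A := by
  ext p q
  fin_cases p <;> fin_cases q <;> simp [pfAdj]

lemma IsSk.transpose {A : Matrix (Fin 6) (Fin 6) R} (h : IsSk A) : Aᵀ = -A := by
  ext p q
  exact h.2 q p

lemma pfAdj_mul {A : Matrix (Fin 6) (Fin 6) R} (h : IsSk A) : pfAdj A * A = pf6 A • 1 := by
  have := congrArg Matrix.transpose (mul_pfAdj h)
  simpa [Matrix.transpose_mul, pfAdj_transpose, h.transpose] using this

lemma pfAdj_neg_pol (A X : Matrix (Fin 6) (Fin 6) R) :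
    pfAdj (A - X) = pfAdj A - pfPol A X + pfAdj X := by
  have key : ∀ i j k l, pf4 (A - X) i j k l = 2 * pf4 A i j k l + 2 * pf4 X i j k l
      - pf4 (A + X) i j k l := by
    intro i j k l
    simp only [pf4, Matrix.sub_apply, Matrix.add_apply]
    ring
  ext p q
  simp only [pfPol, Matrix.sub_apply, Matrix.add_apply]
  fin_cases p <;> fin_cases q <;> simp [pfAdj, key] <;> ring

lemma pf6_pol (A X : Matrix (Fin 6) (Fin 6) R) :
    pf6 (A + X) - pf6 (A - X) - 2 * pf6 X = 2 * pfTau A X := by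
  simp [pf6, pfTau, pfAdj, pf4]
  ring

lemma pol_left [IsDomain R] [CharZero R] {A X : Matrix (Fin 6) (Fin 6) R} (h : IsSk A)
    (hX : IsSk X) : A * pfPol A X + X * pfAdj A = pfTau A X • 1 := by
  have hp : IsSk (A + X) := by
    refine ⟨fun i => by simp [h.1, hX.1], fun i j => ?_⟩
    rw [Matrix.add_apply, Matrix.add_apply, h.2, hX.2]; ring
  have hm : IsSk (A - X) := by
    refine ⟨fun i => by simp [h.1, hX.1], fun i j => ?_⟩
    rw [Matrix.sub_apply, Matrix.sub_apply, h.2, hX.2]; ring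
  have e1 := mul_pfAdj hp
  have e2 := mul_pfAdj hm
  have e3 := mul_pfAdj hX
  have e4 : pfAdj (A + X) = pfAdj A + pfPol A X + pfAdj X := by
    simp only [pfPol]; abel
  rw [pfAdj_neg_pol] at e2
  rw [e4] at e1
  have e5 : (2 : R) • (A * pfPol A X + X * pfAdj A) = (2 : R) • (pfTau A X • 1) := by
    rw [smul_smul, ← pf6_pol, sub_smul, sub_smul, ← e1, ← e2, mul_smul, ← e3, two_smul, two_smul]
    noncomm_ring
  exact smul_right_injective _ (two_ne_zero) e5

lemma pol_right [IsDomain R] [CharZero R] {A X : Matrix (Fin 6) (Fin 6) R} (h : IsSk A) (hX : IsSk X) :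
    pfPol A X * A + pfAdj A * X = pfTau A X • 1 := by
  have := congrArg Matrix.transpose (pol_left h hX)
  have h2 : (pfPol A X)ᵀ = - pfPol A X := by
    simp only [pfPol, Matrix.transpose_sub, pfAdj_transpose]; abel
  simpa [Matrix.transpose_mul, pfAdj_transpose, h.transpose, hX.transpose, h2] using this

def eX (p q : Fin 6) : Matrix (Fin 6) (Fin 6) R := Matrix.single q p 1 - Matrix.single p q 1

lemma isSk_eX (p q : Fin 6) : IsSk (eX p q : Matrix (Fin 6) (Fin 6) R) := by
  constructor
  · intro i
    simp [eX, Matrix.single_apply, and_comm]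
  · intro i j
    simp [eX, Matrix.single_apply, and_comm]

lemma pfTau_eX (A : Matrix (Fin 6) (Fin 6) R) (p q : Fin 6) : pfTau A (eX p q) = pfAdj A p q := by
  fin_cases p <;> fin_cases q <;> simp [pfTau, eX, Matrix.single_apply, pfAdj]

lemma pf4_swap1 {A : Matrix (Fin 6) (Fin 6) R} (h : IsSk A) (i j k l : Fin 6) :
    pf4 A i j k l = - pf4 A j i k l := by
  simp only [pf4]; rw [h.2 i j]; ring

lemma pf4_swap2 {A : Matrix (Fin 6) (Fin 6) R} (h : IsSk A) (i j k l : Fin 6) :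
    pf4 A i j k l = - pf4 A i k j l := by
  simp only [pf4]; rw [h.2 k j]; ring

lemma pf4_swap3 {A : Matrix (Fin 6) (Fin 6) R} (h : IsSk A) (i j k l : Fin 6) :
    pf4 A i j k l = - pf4 A i j l k := by
  simp only [pf4]; rw [h.2 k l]; ring

lemma pf4_sorted {A : Matrix (Fin 6) (Fin 6) R} (hB : pfAdj A = 0)
    (i j k l : Fin 6) (hij : i < j) (hjk : j < k) (hkl : k < l) : pf4 A i j k l = 0 := by
  have e (p q : Fin 6) : pfAdj A p q = 0 := by rw [hB]; rfl
  have hl : (![i, j, k, l] : Fin 4 → Fin 6) ∈ ({![2, 3, 4, 5], ![1, 3, 4, 5], ![1, 2, 4, 5],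
      ![1, 2, 3, 5], ![1, 2, 3, 4], ![0, 3, 4, 5], ![0, 2, 4, 5], ![0, 2, 3, 5], ![0, 2, 3, 4],
      ![0, 1, 4, 5], ![0, 1, 3, 5], ![0, 1, 3, 4], ![0, 1, 2, 5], ![0, 1, 2, 4],
      ![0, 1, 2, 3]} : Finset (Fin 4 → Fin 6)) := by
    revert i j k l; decide
  simp only [Finset.mem_insert, Finset.mem_singleton, vecCons_inj, and_true] at hl
  rcases hl with ⟨rfl, rfl, rfl, rfl⟩ | ⟨rfl, rfl, rfl, rfl⟩ | ⟨rfl, rfl, rfl, rfl⟩ |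
    ⟨rfl, rfl, rfl, rfl⟩ | ⟨rfl, rfl, rfl, rfl⟩ | ⟨rfl, rfl, rfl, rfl⟩ | ⟨rfl, rfl, rfl, rfl⟩ |
    ⟨rfl, rfl, rfl, rfl⟩ | ⟨rfl, rfl, rfl, rfl⟩ | ⟨rfl, rfl, rfl, rfl⟩ | ⟨rfl, rfl, rfl, rfl⟩ |
    ⟨rfl, rfl, rfl, rfl⟩ | ⟨rfl, rfl, rfl, rfl⟩ | ⟨rfl, rfl, rfl, rfl⟩ | ⟨rfl, rfl, rfl, rfl⟩
  · exact e 1 0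
  · exact e 0 2
  · exact e 3 0
  · exact e 0 4
  · exact e 5 0
  · exact e 2 1
  · exact e 1 3
  · exact e 4 1
  · exact e 1 5
  · exact e 3 2
  · exact e 2 4
  · exact e 5 2
  · exact e 4 3
  · exact e 3 5
  · exact e 5 4

lemma pf4_eq_zero {A : Matrix (Fin 6) (Fin 6) R} (h : IsSk A) (hB : pfAdj A = 0)
    (i j k l : Fin 6) (hij : i < j) (hkl : k < l) : pf4 A i j k l = 0 := by
  have s := pf4_sorted hB
  have z1 : ∀ i k l, pf4 A i i k l = 0 := by
    intro i k l; simp only [pf4, h.1]; ring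
  have z2 : ∀ i k l, pf4 A i k k l = 0 := by
    intro i k l; rw [pf4, h.1]; ring
  have z3 : ∀ i k l, pf4 A i k l l = 0 := by
    intro i k l; simp only [pf4, h.1]; ring
  -- first with `j < k` or so, then insert
  have t1 : ∀ i j k l, i < j → i < k → k < l → pf4 A i j k l = 0 := by
    intro i j k l hij hik hkl
    rcases lt_trichotomy j k with hj | rfl | hj
    · exact s i j k l hij hj hkl
    · exact z2 _ _ _
    rw [pf4_swap2 h]
    rcases lt_trichotomy j l with hj' | rfl | hj'
    · rw [s i k j l hik hj hj', neg_zero]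
    · rw [z3, neg_zero]
    · rw [pf4_swap3 h, s i k l j hik hkl hj']; simp
  rcases lt_trichotomy i k with hi | rfl | hi
  · exact t1 i j k l hij hi hkl
  · rw [pf4_swap2 h, z1, neg_zero]
  · -- `k` is the smallest
    have : pf4 A i j k l = pf4 A k l i j := by
      simp only [pf4]; rw [h.2 k i, h.2 l j, h.2 k j, h.2 l i]; ring
    rw [this]
    exact t1 k l i j hkl hi hij

end pfaff

lemma rank_le_two {A : Matrix (Fin 6) (Fin 6) ℂ} (h : IsSk A) (hB : pfAdj A = 0) : A.rank ≤ 2 := by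
  by_cases h0 : A = 0
  · simp [h0]
  obtain ⟨i, j, hij, hne⟩ : ∃ i j, i < j ∧ A i j ≠ 0 := by
    by_contra! hc
    apply h0
    ext i j
    rcases lt_trichotomy i j with hl | hl | hl
    · exact hc i j hl
    · subst hl; exact h.1 i
    · rw [h.2, hc j i hl]; simp
  have key : ∀ k l, pf4 A i j k l = 0 := by
    intro k l
    rcases lt_trichotomy k l with hl | hl | hl
    · exact pf4_eq_zero h hB i j k l hij hl
    · subst hl
      simp only [pf4, h.1]; ring
    · have := pf4_eq_zero h hB i j l k hij hl
      simp only [pf4] at this ⊢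
      rw [h.2 k l]
      linear_combination -this
  have hA : A = vecMulVec (fun k => A i k / A i j) (fun l => A j l)
      + vecMulVec (fun k => - A j k / A i j) (fun l => A i l) := by
    ext k l
    have := key k l
    simp only [pf4] at this
    simp only [Matrix.add_apply, vecMulVec_apply]
    field_simp
    linear_combination this
  have hA' : A = (Matrix.of fun k (s : Fin 2) => ![A i k / A i j, - A j k / A i j] s)
      * (Matrix.of fun (s : Fin 2) l => ![A j l, A i l] s) := by
    rw [hA]
    ext k l
    rw [← hA]
    have := congrFun (congrFun hA k) l
    simp only [Matrix.add_apply, vecMulVec_apply] at this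
    simp [Matrix.mul_apply, Fin.sum_univ_two, ← this]
  rw [hA']
  refine (Matrix.rank_mul_le_left _ _).trans ?_
  exact (Matrix.rank_le_width _)

section hilb
open MvPolynomial

abbrev S4 := MvPolynomial (Fin 4) ℂ
abbrev F6 := Fin 6 → S4

attribute [local instance] MvPolynomial.gradedAlgebra

lemma hc_mul {p : S4} {d : ℕ} (hp : p.IsHomogeneous d) (q : S4) (n : ℕ) :
    homogeneousComponent n (p * q) = if d ≤ n then p * homogeneousComponent (n - d) q else 0 := by
  have := DirectSum.coe_decompose_mul_of_left_mem (homogeneousSubmodule (Fin 4) ℂ) (b := q) n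
    ((mem_homogeneousSubmodule d p).2 hp)
  have e : ∀ (r : S4) (k : ℕ), ((DirectSum.decompose (homogeneousSubmodule (Fin 4) ℂ) r k : _) : S4)
      = homogeneousComponent k r := fun r k => decomposition.decompose'_apply r k
  rw [e, e] at this
  exact this

/-- degree `t` component of a vector -/
noncomputable def hcp (t : ℕ) : F6 →ₗ[ℂ] F6 where
  toFun v i := homogeneousComponent t (v i)
  map_add' v w := by ext1 i; simp
  map_smul' c v := by ext1 i; simp

lemma hcp_apply (t : ℕ) (v : F6) (i : Fin 6) : hcp t v i = homogeneousComponent t (v i) := rfl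

/-- vectors homogeneous of degree `t` -/
def Fd (t : ℕ) : Submodule ℂ F6 where
  carrier := {v | ∀ i, (v i).IsHomogeneous t}
  add_mem' := fun h1 h2 i => (h1 i).add (h2 i)
  zero_mem' := fun _ => isHomogeneous_zero _ _ _
  smul_mem' := fun c _ h i => (homogeneousSubmodule (Fin 4) ℂ t).smul_mem c (h i)

lemma mem_Fd {t : ℕ} {v : F6} : v ∈ Fd t ↔ ∀ i, (v i).IsHomogeneous t := Iff.rfl

lemma hcp_mem (t : ℕ) (v : F6) : hcp t v ∈ Fd t := fun i =>
  homogeneousComponent_isHomogeneous t (v i)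

lemma hcp_self {t : ℕ} {v : F6} (h : v ∈ Fd t) : hcp t v = v := by
  ext1 i
  exact homogeneousComponent_eq_self (h i)

noncomputable def FdEquiv (t : ℕ) : Fd t ≃ₗ[ℂ] (Fin 6 → homogeneousSubmodule (Fin 4) ℂ t) where
  toFun v i := ⟨v.1 i, v.2 i⟩
  invFun w := ⟨fun i => (w i).1, fun i => (w i).2⟩
  map_add' _ _ := rfl
  map_smul' _ _ := rfl
  left_inv _ := rfl
  right_inv _ := rfl

instance (t : ℕ) : Module.Finite ℂ (homogeneousSubmodule (Fin 4) ℂ t) :=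
  Module.Finite.iff_fg.2 (homogeneousSubmodule_fg (Fin 4) ℂ t)

instance (t : ℕ) : Module.Finite ℂ (Fd t) := Module.Finite.equiv (FdEquiv t).symm

lemma finrank_hom (t : ℕ) :
    Module.finrank ℂ (homogeneousSubmodule (Fin 4) ℂ t) = (t + 3).choose 3 := by
  rw [homogeneousSubmodule_eq_finsupp_supported,
    (AddMonoidAlgebra.supportedEquivFinsupp (R := ℂ) (S := ℂ)
      {d : Fin 4 →₀ ℕ | d.degree = t}).finrank_eq]
  have hs : {d : Fin 4 →₀ ℕ | d.degree = t}
      = ((Finset.univ : Finset (Fin 4)).finsuppAntidiag t : Set (Fin 4 →₀ ℕ)) := by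
    ext d
    simp [Finsupp.degree_eq_sum]
  rw [hs, Module.finrank_finsupp_self]
  simp only [Finset.coe_sort_coe, Fintype.card_coe]
  rw [Finset.card_finsuppAntidiag_nat_eq_choose]
  simp only [Finset.card_univ, Fintype.card_fin]
  rw [show 4 + t - 1 = t + 3 by omega]
  exact Nat.choose_symm_add

lemma finrank_Fd (t : ℕ) : Module.finrank ℂ (Fd t) = 6 * (t + 3).choose 3 := by
  rw [(FdEquiv t).finrank_eq, Module.finrank_pi_fintype]
  simp [finrank_hom]

def HomSub (N : Submodule S4 F6) : Prop := ∀ t, ∀ v ∈ N, hcp t v ∈ N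

/-- degree t part of a submodule -/
noncomputable def gr (N : Submodule S4 F6) (t : ℕ) : Submodule ℂ F6 := N.restrictScalars ℂ ⊓ Fd t

lemma mem_gr {N : Submodule S4 F6} {t : ℕ} {v : F6} : v ∈ gr N t ↔ v ∈ N ∧ v ∈ Fd t := Iff.rfl

instance (N : Submodule S4 F6) (t : ℕ) : Module.Finite ℂ (gr N t) :=
  Submodule.finiteDimensional_of_le (inf_le_right : gr N t ≤ Fd t)

noncomputable def hf (N : Submodule S4 F6) (t : ℕ) : ℤ := Module.finrank ℂ (gr N t)

lemma hf_top (t : ℕ) : hf ⊤ t = 6 * (t + 3).choose 3 := by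
  have : gr ⊤ t = Fd t := by ext; simp [mem_gr]
  rw [hf, this, finrank_Fd]; push_cast; ring

lemma hcp_smul {p : S4} {d : ℕ} (hp : p.IsHomogeneous d) (v : F6) (n : ℕ) :
    hcp n (p • v) = if d ≤ n then p • hcp (n - d) v else 0 := by
  ext1 i
  simp only [hcp_apply, Pi.smul_apply, smul_eq_mul, hc_mul hp]
  split_ifs <;> simp [hcp_apply]

/-- finite-length lemma -/
lemma fin_len (L N : Submodule S4 F6) (hN : HomSub N) (M : ℕ)
    (h : ∀ j, M ≤ j → ∀ p : S4, p.IsHomogeneous j → ∀ v ∈ L, p • v ∈ N) :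
    ∃ T, ∀ t, T ≤ t → ∀ v ∈ L, v ∈ Fd t → v ∈ N := by
  obtain ⟨G, hG⟩ : L.FG := IsNoetherian.noetherian L
  let D := G.sup fun g => Finset.univ.sup fun i => (g i).totalDegree
  have hD : ∀ g ∈ G, ∀ i, (g i).totalDegree ≤ D := fun g hg i =>
    (Finset.le_sup (f := fun i => (g i).totalDegree) (Finset.mem_univ i)).trans
      (Finset.le_sup (f := fun g : F6 => Finset.univ.sup fun i => (g i).totalDegree) hg)
  have one : ∀ g ∈ G, ∀ p : S4, ∀ t, D + M + 1 ≤ t → hcp t (p • g) ∈ N := by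
    intro g hg p t ht
    have hgL : g ∈ L := by rw [← hG]; exact Submodule.subset_span hg
    rw [← sum_homogeneousComponent p, Finset.sum_smul, map_sum]
    refine N.sum_mem fun j _ => ?_
    rcases le_or_gt M j with hj | hj
    · exact hN _ _ (h j hj _ (homogeneousComponent_isHomogeneous j p) g hgL)
    · rw [hcp_smul (homogeneousComponent_isHomogeneous j p)]
      split_ifs
      · have : hcp (t - j) g = 0 := by
          ext1 i
          refine homogeneousComponent_eq_zero _ _ ?_
          have := hD g hg i
          omega
        rw [this, smul_zero]
        exact N.zero_mem
      · exact N.zero_mem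
  refine ⟨D + M + 1, fun t ht v hv hvt => ?_⟩
  rw [← hG, Submodule.mem_span_finset] at hv
  obtain ⟨f, -, rfl⟩ := hv
  rw [← hcp_self hvt, map_sum]
  exact N.sum_mem fun g hg => one g hg _ t ht

def annI (L N : Submodule S4 F6) : Ideal S4 where
  carrier := {p | ∀ v ∈ L, p • v ∈ N}
  add_mem' := fun ha hb v hv => by rw [add_smul]; exact N.add_mem (ha v hv) (hb v hv)
  zero_mem' := fun v _ => by rw [zero_smul]; exact N.zero_mem
  smul_mem' := fun c p hp v hv => by
    rw [smul_eq_mul, mul_smul]; exact N.smul_mem c (hp v hv)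

lemma hom_mem_pow {p : S4} {j n : ℕ} (hp : p.IsHomogeneous j) (hn : n ≤ j) :
    p ∈ (Ideal.span (Set.range (X : Fin 4 → S4))) ^ n := by
  refine Ideal.pow_le_pow_right hn ?_
  rw [Ideal.mem_span_pow_iff_exists_isHomogeneous]
  refine ⟨p.map C, hp.map _, ?_⟩
  rw [eval_map]
  exact eval₂_eta p

/-- eventual vanishing of the `n`-th difference -/
def EvZ : ℕ → (ℕ → ℤ) → Prop
  | 0, f => ∃ T, ∀ t, T ≤ t → f t = 0
  | n + 1, f => EvZ n (fun t => f (t + 1) - f t)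

lemma EvZ.comb (n : ℕ) : ∀ f g : ℕ → ℤ, EvZ n f → EvZ n g → EvZ n (fun t => f (t + 1) - g t) := by
  induction n with
  | zero =>
    rintro f g ⟨T, hT⟩ ⟨U, hU⟩
    refine ⟨max T U, fun t ht => ?_⟩
    simp only
    rw [hT (t + 1) (by omega), hU t (by omega), sub_zero]
  | succ n ih =>
    intro f g hf hg
    have := ih _ _ hf hg
    simp only [EvZ] at this ⊢
    convert this using 2
    ring

noncomputable def mulX (k : Fin 4) : F6 →ₗ[S4] F6 := LinearMap.lsmul S4 F6 (X k)

lemma mulX_apply (k : Fin 4) (v : F6) : mulX k v = (X k : S4) • v := rfl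

lemma mulX_inj (k : Fin 4) : Function.Injective (mulX k) := by
  intro v w h
  simp only [mulX_apply] at h
  exact smul_right_injective F6 (X_ne_zero k) h

lemma mulX_mem {k : Fin 4} {t : ℕ} {v : F6} (h : v ∈ Fd t) : mulX k v ∈ Fd (t + 1) := by
  intro i
  rw [add_comm]
  exact (isHomogeneous_X ℂ k).mul (h i)

lemma hcp_mulX (k : Fin 4) (t : ℕ) (v : F6) : hcp (t + 1) (mulX k v) = mulX k (hcp t v) := by
  rw [mulX_apply, hcp_smul (isHomogeneous_X ℂ k), if_pos (by omega)]
  rfl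

lemma hcp_mulX_zero (k : Fin 4) (v : F6) : hcp 0 (mulX k v) = 0 := by
  rw [mulX_apply, hcp_smul (isHomogeneous_X ℂ k), if_neg (by omega)]

lemma HomSub.map {L : Submodule S4 F6} (hL : HomSub L) (k : Fin 4) : HomSub (L.map (mulX k)) := by
  rintro t _ ⟨v, hv, rfl⟩
  cases t with
  | zero => rw [hcp_mulX_zero]; exact Submodule.zero_mem _
  | succ t => rw [hcp_mulX]; exact ⟨_, hL t v hv, rfl⟩

lemma HomSub.sup {L N : Submodule S4 F6} (hL : HomSub L) (hN : HomSub N) : HomSub (L ⊔ N) := by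
  intro t v hv
  obtain ⟨a, ha, b, hb, rfl⟩ := Submodule.mem_sup.1 hv
  rw [map_add]
  exact Submodule.add_mem_sup (hL t a ha) (hN t b hb)

lemma HomSub.inf_comap {L N : Submodule S4 F6} (hL : HomSub L) (hN : HomSub N) (k : Fin 4) :
    HomSub (L ⊓ N.comap (mulX k)) := by
  rintro t v ⟨h1, h2⟩
  refine ⟨hL t v h1, ?_⟩
  have := hN (t + 1) _ h2
  rwa [hcp_mulX] at this

lemma hf_step {L N : Submodule S4 F6} (hL : HomSub L) (hN : HomSub N) (k : Fin 4) (t : ℕ) :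
    hf (L.map (mulX k) ⊔ N) (t + 1) + hf (L ⊓ N.comap (mulX k)) t = hf L t + hf N (t + 1) := by
  let m : F6 →ₗ[ℂ] F6 := (mulX k).restrictScalars ℂ
  have hm : Function.Injective m := mulX_inj k
  have e1 : gr (L.map (mulX k) ⊔ N) (t + 1) = (gr L t).map m ⊔ gr N (t + 1) := by
    apply le_antisymm
    · rintro v ⟨h1, h2⟩
      obtain ⟨_, ⟨a, ha, rfl⟩, b, hb, rfl⟩ := Submodule.mem_sup.1 h1
      rw [← hcp_self h2, map_add, hcp_mulX]
      exact Submodule.add_mem_sup ⟨_, ⟨hL t a ha, hcp_mem t a⟩, rfl⟩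
        ⟨hN _ b hb, hcp_mem _ b⟩
    · refine sup_le ?_ ?_
      · rintro _ ⟨a, ⟨h1, h2⟩, rfl⟩
        exact ⟨Submodule.mem_sup_left ⟨a, h1, rfl⟩, mulX_mem h2⟩
      · rintro b ⟨h1, h2⟩
        exact ⟨Submodule.mem_sup_right h1, h2⟩
  have e2 : (gr L t).map m ⊓ gr N (t + 1) = (gr (L ⊓ N.comap (mulX k)) t).map m := by
    apply le_antisymm
    · rintro _ ⟨⟨a, ⟨h1, h2⟩, rfl⟩, ⟨h3, h4⟩⟩
      exact ⟨a, ⟨⟨h1, h3⟩, h2⟩, rfl⟩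
    · rintro _ ⟨a, ⟨⟨h1, h3⟩, h2⟩, rfl⟩
      exact ⟨⟨a, ⟨h1, h2⟩, rfl⟩, ⟨h3, mulX_mem h2⟩⟩
  have e3 := Submodule.finrank_sup_add_finrank_inf_eq ((gr L t).map m) (gr N (t + 1))
  rw [← e1, e2, ← (Submodule.equivMapOfInjective m hm (gr L t)).finrank_eq,
    ← (Submodule.equivMapOfInjective m hm (gr (L ⊓ N.comap (mulX k)) t)).finrank_eq] at e3
  simp only [hf]
  exact_mod_cast e3

theorem hilbert_serre (n : ℕ) : n ≤ 4 → ∀ L N : Submodule S4 F6, HomSub L → HomSub N → N ≤ L →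
    (∀ j : Fin 4, n ≤ j.val → ∀ v ∈ L, mulX j v ∈ N) → EvZ n (fun t => hf L t - hf N t) := by
  induction n with
  | zero =>
    intro _ L N hL hN hNL hk
    obtain ⟨T, hT⟩ := fin_len L N hN 1 (by
      intro j hj p hp
      have h1 : Ideal.span (Set.range (X : Fin 4 → S4)) ≤ annI L N := by
        rw [Ideal.span_le]
        rintro _ ⟨k, rfl⟩
        exact hk k (Nat.zero_le _)
      have h2 := hom_mem_pow hp hj
      rw [pow_one] at h2
      exact h1 h2)
    refine ⟨T, fun t ht => ?_⟩
    have : gr L t = gr N t := by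
      apply le_antisymm
      · rintro v ⟨h1, h2⟩
        exact ⟨hT t ht v h1 h2, h2⟩
      · rintro v ⟨h1, h2⟩
        exact ⟨hNL h1, h2⟩
    simp only [hf]
    rw [this, sub_self]
  | succ n ih =>
    intro hn L N hL hN hNL hk
    let k : Fin 4 := ⟨n, by omega⟩
    have hLX : ∀ v ∈ L, mulX k v ∈ L := fun v hv => L.smul_mem _ hv
    have i1 := ih (by omega) L (L.map (mulX k) ⊔ N) hL ((hL.map k).sup hN)
      (sup_le (by rintro _ ⟨v, hv, rfl⟩; exact hLX v hv) hNL) (by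
        intro j hj v hv
        rcases eq_or_lt_of_le hj with h | h
        · have : j = k := Fin.ext h.symm
          subst this
          exact Submodule.mem_sup_left ⟨v, hv, rfl⟩
        · exact Submodule.mem_sup_right (hk j h v hv))
    have i2 := ih (by omega) (L ⊓ N.comap (mulX k)) N (hL.inf_comap hN k) hN
      (fun v hv => ⟨hNL hv, N.smul_mem _ hv⟩) (by
        intro j hj v hv
        rcases eq_or_lt_of_le hj with h | h
        · have : j = k := Fin.ext h.symm
          subst this
          exact hv.2
        · exact hk j h v hv.1)
    have := EvZ.comb n _ _ i1 i2
    simp only [EvZ]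
    convert this using 2 with t
    have := hf_step hL hN k t
    linarith

lemma hcp_mulVec {P : Matrix (Fin 6) (Fin 6) S4} {d : ℕ} (hP : ∀ i j, (P i j).IsHomogeneous d)
    (u : F6) (n : ℕ) : hcp n (P *ᵥ u) = if d ≤ n then P *ᵥ hcp (n - d) u else 0 := by
  ext1 i
  rw [hcp_apply]
  simp only [Matrix.mulVec, dotProduct, map_sum, hc_mul (hP _ _)]
  split_ifs
  · rfl
  · simp

lemma homSub_ker {P : Matrix (Fin 6) (Fin 6) S4} {d : ℕ} (hP : ∀ i j, (P i j).IsHomogeneous d) :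
    HomSub (LinearMap.ker P.mulVecLin) := by
  intro t v hv
  rw [LinearMap.mem_ker, Matrix.mulVecLin_apply] at hv ⊢
  have := hcp_mulVec hP v (t + d)
  rw [hv, if_pos (by omega), map_zero, Nat.add_sub_cancel] at this
  exact this.symm

lemma homSub_range {P : Matrix (Fin 6) (Fin 6) S4} {d : ℕ} (hP : ∀ i j, (P i j).IsHomogeneous d) :
    HomSub (LinearMap.range P.mulVecLin) := by
  rintro t _ ⟨u, rfl⟩
  rw [Matrix.mulVecLin_apply, hcp_mulVec hP]
  split_ifs
  · exact ⟨_, rfl⟩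
  · exact Submodule.zero_mem _

lemma exact_count {P : Matrix (Fin 6) (Fin 6) S4} {d : ℕ} (hP : ∀ i j, (P i j).IsHomogeneous d)
    (L : Submodule S4 F6) (hPL : LinearMap.range P.mulVecLin ≤ L)
    (hrad : ∀ k, X k ∈ (annI L (LinearMap.range P.mulVecLin)).radical) :
    ∃ T, ∀ t, T ≤ t → hf L (t + d) + hf (LinearMap.ker P.mulVecLin) t = hf ⊤ t := by
  have h1 : Ideal.span (Set.range (X : Fin 4 → S4)) ≤
      (annI L (LinearMap.range P.mulVecLin)).radical := by
    rw [Ideal.span_le]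
    rintro _ ⟨k, rfl⟩
    exact hrad k
  obtain ⟨M, hM⟩ := Ideal.exists_pow_le_of_le_radical_of_fg h1 (IsNoetherian.noetherian _)
  obtain ⟨T, hT⟩ := fin_len L _ (homSub_range hP) M
    (fun j hj p hp => hM (hom_mem_pow hp hj))
  refine ⟨T, fun t ht => ?_⟩
  let φ : Fd t →ₗ[ℂ] F6 := (P.mulVecLin.restrictScalars ℂ).domRestrict (Fd t)
  have e0 := LinearMap.finrank_range_add_finrank_ker φ
  have e1 : LinearMap.range φ = gr L (t + d) := by
    apply le_antisymm
    · rintro _ ⟨⟨u, hu⟩, rfl⟩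
      refine ⟨hPL ⟨u, rfl⟩, ?_⟩
      intro i
      change (P.mulVecLin u i).IsHomogeneous (t + d)
      rw [Matrix.mulVecLin_apply, Matrix.mulVec, dotProduct, add_comm]
      exact IsHomogeneous.sum _ _ _ fun j _ => (hP i j).mul (hu j)
    · rintro v ⟨h1, h2⟩
      obtain ⟨u, rfl⟩ := hT (t + d) (by omega) v h1 h2
      refine ⟨⟨hcp t u, hcp_mem t u⟩, ?_⟩
      change P.mulVecLin (hcp t u) = _
      rw [← hcp_self h2, Matrix.mulVecLin_apply, Matrix.mulVecLin_apply, hcp_mulVec hP,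
        if_pos (by omega), Nat.add_sub_cancel]
  have e2 : LinearMap.ker φ = (gr (LinearMap.ker P.mulVecLin) t).comap (Fd t).subtype := by
    ext ⟨u, hu⟩
    exact ⟨fun h => ⟨h, hu⟩, fun h => h.1⟩
  rw [e1, e2, (Submodule.comapSubtypeEquivOfLe
    (show gr (LinearMap.ker P.mulVecLin) t ≤ Fd t from inf_le_right)).finrank_eq, finrank_Fd] at e0
  rw [hf_top]
  simp only [hf]
  exact_mod_cast e0

lemma arith (k : ℕ → ℤ) (h4 : EvZ 4 k) (T : ℕ)
    (h3 : ∀ t, T ≤ t → k (t + 3) - k t = hf ⊤ (t + 1) - hf ⊤ t) : False := by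
  obtain ⟨U, hU⟩ := h4
  have hc : ∀ t : ℕ, hf ⊤ (t + 1) - hf ⊤ t = 3 * (((t : ℤ) + 3) * (t + 2)) := by
    intro t
    rw [hf_top, hf_top]
    have h1 : (t + 1 + 3).choose 3 = (t + 3).choose 2 + (t + 3).choose 3 :=
      Nat.choose_succ_succ (t + 3) 2
    have h2 : (t + 3).choose 2 * 2 = (t + 3) * (t + 2) := by
      rw [Nat.choose_two_right]
      exact Nat.div_mul_cancel (Nat.even_mul_pred_self (t + 3)).two_dvd
    have h2' : (((t + 3).choose 2 : ℕ) : ℤ) * 2 = (t + 3) * (t + 2) := by exact_mod_cast h2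
    rw [h1]
    push_cast
    linarith
  obtain ⟨V, hVT, hVU⟩ : ∃ V, T ≤ V ∧ U ≤ V := ⟨max T U, le_max_left _ _, le_max_right _ _⟩
  have a0 := h3 V hVT
  have a1 := h3 (V + 1) (by omega)
  have a2 := h3 (V + 2) (by omega)
  have b0 := hU V hVU
  have b1 := hU (V + 1) (by omega)
  rw [hc] at a0 a1 a2
  push_cast at a0 a1 a2
  simp only [add_assoc] at a0 a1 a2 b0 b1
  norm_num at a0 a1 a2 b0 b1
  ring_nf at a0 a1 a2 b0 b1
  generalize (V : ℤ) ^ 2 = W at *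
  generalize (V : ℤ) = Z at *
  omega

end hilb

section main
open MvPolynomial

lemma pf4_map {R R' : Type*} [CommRing R] [CommRing R'] (f : R →+* R')
    (A : Matrix (Fin 6) (Fin 6) R) (i j k l : Fin 6) : pf4 (A.map f) i j k l = f (pf4 A i j k l) := by
  simp [pf4]

lemma pfAdj_map {R R' : Type*} [CommRing R] [CommRing R'] (f : R →+* R')
    (A : Matrix (Fin 6) (Fin 6) R) (p q : Fin 6) : pfAdj (A.map f) p q = f (pfAdj A p q) := by
  fin_cases p <;> fin_cases q <;> simp [pfAdj, pf4_map]

lemma pf6_map {R R' : Type*} [CommRing R] [CommRing R'] (f : R →+* R')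
    (A : Matrix (Fin 6) (Fin 6) R) : pf6 (A.map f) = f (pf6 A) := by
  simp only [pf6, pfAdj_map, Matrix.map_apply, map_neg, map_add, map_mul]

lemma pfAdj_hom {A : Matrix (Fin 6) (Fin 6) S4} (hA : ∀ i j, (A i j).IsHomogeneous 1)
    (p q : Fin 6) : (pfAdj A p q).IsHomogeneous 2 := by
  have h : ∀ i j k l, (pf4 A i j k l).IsHomogeneous 2 := fun i j k l =>
    (((hA i j).mul (hA k l)).sub ((hA i k).mul (hA j l))).add ((hA i l).mul (hA j k))
  fin_cases p <;> fin_cases q <;>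
    first
    | exact isHomogeneous_zero _ _ _
    | exact h _ _ _ _
    | exact (h _ _ _ _).neg

/-- The core statement for a linear matrix. -/
lemma core (A : Matrix (Fin 6) (Fin 6) S4) (hA : ∀ i j, (A i j).IsHomogeneous 1) (hs : IsSk A)
    (h6 : pf6 A = 0) (hz : ∀ x : Fin 4 → ℂ, (∀ p q, eval x (pfAdj A p q) = 0) → x = 0) : False := by
  have hAB : A * pfAdj A = 0 := by rw [mul_pfAdj hs, h6, zero_smul]
  have hBA : pfAdj A * A = 0 := by rw [pfAdj_mul hs, h6, zero_smul]
  have hB := pfAdj_hom hA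
  have rad : ∀ J : Ideal S4, (∀ p q, pfAdj A p q ∈ J) → ∀ k, X k ∈ J.radical := by
    intro J hJ k
    rw [← vanishingIdeal_zeroLocus_eq_radical (K := ℂ) J, mem_vanishingIdeal_iff]
    intro x hx
    have : x = 0 := hz x fun p q => by
      have := hx _ (hJ p q)
      rwa [aeval_eq_eval] at this
    simp [this]
  obtain ⟨T1, hT1⟩ := exact_count hA (LinearMap.ker (pfAdj A).mulVecLin) (by
      rintro _ ⟨u, rfl⟩
      simp [Matrix.mulVec_mulVec, hBA]) (rad _ fun p q v hv => by
      rw [LinearMap.mem_ker, Matrix.mulVecLin_apply] at hv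
      have := congrArg (fun M => M *ᵥ v) (pol_left hs (isSk_eX p q))
      simp only [Matrix.add_mulVec, ← Matrix.mulVec_mulVec, hv, Matrix.mulVec_zero, add_zero,
        pfTau_eX, Matrix.smul_mulVec, Matrix.one_mulVec] at this
      exact ⟨_, this⟩)
  obtain ⟨T2, hT2⟩ := exact_count hB (LinearMap.ker A.mulVecLin) (by
      rintro _ ⟨u, rfl⟩
      simp [Matrix.mulVec_mulVec, hAB]) (rad _ fun p q v hv => by
      rw [LinearMap.mem_ker, Matrix.mulVecLin_apply] at hv
      have := congrArg (fun M => M *ᵥ v) (pol_right hs (isSk_eX p q))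
      simp only [Matrix.add_mulVec, ← Matrix.mulVec_mulVec, hv, Matrix.mulVec_zero, zero_add,
        pfTau_eX, Matrix.smul_mulVec, Matrix.one_mulVec] at this
      exact ⟨_, this⟩)
  have hbot : ∀ t, hf ⊥ t = 0 := by
    intro t
    have : gr ⊥ t = ⊥ := by
      rw [eq_bot_iff]
      rintro v ⟨h1, -⟩
      exact h1
    rw [hf, this, finrank_bot, Nat.cast_zero]
  have hS := hilbert_serre 4 le_rfl (LinearMap.ker A.mulVecLin) ⊥ (homSub_ker hA)
    (fun t v hv => by rw [(Submodule.mem_bot _).1 hv, map_zero]; exact Submodule.zero_mem _) bot_le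
    (fun j hj => absurd j.isLt (by omega))
  simp only [hbot, sub_zero] at hS
  refine arith _ hS (max T1 T2) fun t ht => ?_
  have e1 := hT1 t (by omega)
  have e2 := hT2 (t + 1) (by omega)
  rw [show t + 1 + 2 = t + 3 by ring] at e2
  linarith

end main

/-- There is no 4-dimensional space of skew-symmetric `6×6` complex
matrices of constant rank 4. -/
theorem stmt_13 :
    ¬ ∃ M : Submodule ℂ (Matrix (Fin 6) (Fin 6) ℂ),
      Module.finrank ℂ M = 4 ∧ (∀ A ∈ M, Aᵀ = -A) ∧ (∀ A ∈ M, A ≠ 0 → A.rank = 4) := by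
  rintro ⟨M, hM, hskew, hrank⟩
  let b : Module.Basis (Fin 4) ℂ M := Module.finBasisOfFinrankEq ℂ M hM
  have sk : ∀ B ∈ M, IsSk B := by
    intro B hB
    have h : ∀ i j, B i j = - B j i := fun i j => congrFun (congrFun (hskew B hB) j) i
    exact ⟨fun i => self_eq_neg.1 (h i i), h⟩
  let A : Matrix (Fin 6) (Fin 6) S4 := Matrix.of fun i j =>
    ∑ k, MvPolynomial.C ((b k).1 i j) * MvPolynomial.X k
  have hAx : ∀ x : Fin 4 → ℂ, A.map (MvPolynomial.eval x) = (∑ k, x k • b k : M).1 := by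
    intro x
    ext i j
    simp [A, Matrix.sum_apply, mul_comm]
  have hmem : ∀ x : Fin 4 → ℂ, A.map (MvPolynomial.eval x) ∈ M := fun x => by
    rw [hAx]; exact Subtype.mem _
  refine core A ?_ ?_ ?_ ?_
  · intro i j
    simp only [A, Matrix.of_apply]
    exact MvPolynomial.IsHomogeneous.sum Finset.univ _ 1 fun k _ =>
      MvPolynomial.isHomogeneous_C_mul_X ((b k).1 i j) k
  · refine ⟨fun i => ?_, fun i j => ?_⟩
    · simp only [A, Matrix.of_apply]
      exact Finset.sum_eq_zero fun k _ => by rw [(sk _ (b k).2).1 i]; simp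
    · simp only [A, Matrix.of_apply]
      rw [← Finset.sum_neg_distrib]
      exact Finset.sum_congr rfl fun k _ => by rw [(sk _ (b k).2).2 i j]; simp
  · apply MvPolynomial.funext
    intro x
    rw [map_zero, ← pf6_map]
    by_contra hne
    have h1 := mul_pfAdj (sk _ (hmem x))
    have hu : IsUnit (A.map (MvPolynomial.eval x)) := by
      refine (Matrix.isUnit_iff_isUnit_det _).2 (isUnit_iff_ne_zero.2 fun h0 => ?_)
      have h2 := congrArg Matrix.det h1
      rw [Matrix.det_mul, h0, zero_mul, Matrix.det_smul, Matrix.det_one, mul_one] at h2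
      exact pow_ne_zero _ hne h2.symm
    have h6 := Matrix.rank_of_isUnit _ hu
    have h4 := hrank _ (hmem x) (by rintro h; rw [h] at h6; simp at h6)
    rw [h4] at h6
    simp at h6
  · intro x hx
    have hB : pfAdj (A.map (MvPolynomial.eval x)) = 0 := by
      ext p q
      rw [pfAdj_map, hx]; rfl
    have h2 := rank_le_two (sk _ (hmem x)) hB
    have h0 : A.map (MvPolynomial.eval x) = 0 := by
      by_contra hne
      rw [hrank _ (hmem x) hne] at h2
      omega
    rw [hAx] at h0
    have h0' : (∑ k, x k • b k : M) = 0 := Subtype.ext h0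
    funext k
    exact Fintype.linearIndependent_iff.1 b.linearIndependent x h0' k
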